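/- Let {A_k}_{k=1}^∞ ⊆ F satisfy A_j ∩ A_k ∈ N whenever j ≠ k. Then there exist sets B_k ∈ F (k ∈ ℕ) such that: (1) A_k △ B_k ∈ N for each k; (2) the B_k are pairwise disjoint; (3) A := ⋃_{k=1}^∞ B_k ∈ F with ν(A) = ∑_{k=1}^∞ ν(B_k); and (4) A is a least upper bound modulo null sets: for any C ⊆ ℕ such that A_k ∖ C ∈ N for all k, one has A ∖ C ∈ N. -/

import Mathlib

/-- The partial average `ν_N(A) = (1/N)·∑_{n=1}^N 1_A(n)`. -/
noncomputable def nuN (A : Set ℕ) (N : ℕ) : ℝ :=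
  (∑ n ∈ Finset.Icc 1 N, A.indicator (fun _ => (1 : ℝ)) n) / N

/-- The upper Cesàro limit `ν⁺(A)`. -/
noncomputable def nuPlus (A : Set ℕ) : ℝ :=
  Filter.limsup (fun N => nuN A N) Filter.atTop

/-- The lower Cesàro limit `ν⁻(A)`. -/
noncomputable def nuMinus (A : Set ℕ) : ℝ :=
  Filter.liminf (fun N => nuN A N) Filter.atTop

/-- `A ∈ F`: the Cesàro limit of `A` exists. -/
def memF (A : Set ℕ) : Prop :=
  ∃ l : ℝ, Filter.Tendsto (fun N => nuN A N) Filter.atTop (nhds l)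

/-- The Cesàro limit `ν(A)`; it coincides with `ν⁺(A)` whenever `A ∈ F`. -/
noncomputable def nu (A : Set ℕ) : ℝ := nuPlus A

/-- `A ∈ N`: `A` is a null set. -/
def nullSet (A : Set ℕ) : Prop := memF A ∧ nu A = 0

open Filter Topology

theorem memF_of_tendsto {A : Set ℕ} {l : ℝ} (h : Tendsto (nuN A) atTop (𝓝 l)) : memF A :=
  ⟨l, h⟩

theorem nu_eq_of_tendsto {A : Set ℕ} {l : ℝ} (h : Tendsto (nuN A) atTop (𝓝 l)) : nu A = l :=
  h.limsup_eq

theorem memF.tendsto_nu {A : Set ℕ} (h : memF A) : Tendsto (nuN A) atTop (𝓝 (nu A)) := by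
  obtain ⟨l, hl⟩ := h
  rwa [nu_eq_of_tendsto hl]

theorem nullSet_iff_tendsto {A : Set ℕ} : nullSet A ↔ Tendsto (nuN A) atTop (𝓝 0) :=
  ⟨fun h => h.2 ▸ h.1.tendsto_nu, fun h => ⟨memF_of_tendsto h, nu_eq_of_tendsto h⟩⟩

theorem nuN_nonneg (A : Set ℕ) (N : ℕ) : 0 ≤ nuN A N :=
  div_nonneg (Finset.sum_nonneg fun _ _ => Set.indicator_nonneg (fun _ _ => zero_le_one) _)
    N.cast_nonneg

theorem nuN_mono {A B : Set ℕ} (h : A ⊆ B) (N : ℕ) : nuN A N ≤ nuN B N :=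
  div_le_div_of_nonneg_right
    (Finset.sum_le_sum fun n _ =>
      Set.indicator_le_indicator_of_subset h (fun _ => zero_le_one) n)
    N.cast_nonneg

theorem nuN_le_one (A : Set ℕ) (N : ℕ) : nuN A N ≤ 1 := by
  refine div_le_one_of_le₀ ?_ N.cast_nonneg
  calc _ ≤ ∑ n ∈ Finset.Icc 1 N, (1 : ℝ) :=
        Finset.sum_le_sum fun n _ => Set.indicator_le_self' (fun _ _ => zero_le_one) n
    _ = N := by simp

theorem nuN_union_le (A B : Set ℕ) (N : ℕ) : nuN (A ∪ B) N ≤ nuN A N + nuN B N := by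
  rw [nuN, nuN, nuN, ← add_div, ← Finset.sum_add_distrib]
  refine div_le_div_of_nonneg_right (Finset.sum_le_sum fun n _ => ?_) N.cast_nonneg
  by_cases hA : n ∈ A <;> by_cases hB : n ∈ B <;> simp [hA, hB]

theorem abs_nuN_sub_le (A B : Set ℕ) (N : ℕ) : |nuN A N - nuN B N| ≤ nuN (symmDiff A B) N := by
  have hA : nuN A N ≤ nuN B N + nuN (symmDiff A B) N :=
    (nuN_mono (fun n hn => by
      by_cases n ∈ B <;> simp_all [Set.mem_symmDiff]) N).trans (nuN_union_le _ _ N)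
  have hB : nuN B N ≤ nuN A N + nuN (symmDiff A B) N :=
    (nuN_mono (fun n hn => by
      by_cases n ∈ A <;> simp_all [Set.mem_symmDiff]) N).trans (nuN_union_le _ _ N)
  exact abs_le.2 ⟨by linarith, by linarith⟩

theorem hasSum_nuN_iUnion {D : ℕ → Set ℕ} (hD : Pairwise (Function.onFun Disjoint D)) (N : ℕ) :
    HasSum (fun k => nuN (D k) N) (nuN (⋃ k, D k) N) := by
  refine HasSum.div_const (hasSum_sum fun n _ => ?_) _
  by_cases hn : ∃ k, n ∈ D k
  · obtain ⟨k, hk⟩ := hn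
    have hsingle := hasSum_single (f := fun j => (D j).indicator (fun _ => (1 : ℝ)) n) k
      fun j hj => Set.indicator_of_notMem (fun hnj => Set.disjoint_left.1 (hD hj) hnj hk) _
    rw [Set.indicator_of_mem hk] at hsingle
    rw [Set.indicator_of_mem (Set.mem_iUnion.2 ⟨k, hk⟩)]
    exact hsingle
  · push Not at hn
    simp [hn, hasSum_zero]

theorem nullSet.mono {A B : Set ℕ} (hB : nullSet B) (h : A ⊆ B) : nullSet A :=
  nullSet_iff_tendsto.2 <|
    squeeze_zero (nuN_nonneg A) (nuN_mono h) (nullSet_iff_tendsto.1 hB)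

theorem nullSet.union {A B : Set ℕ} (hA : nullSet A) (hB : nullSet B) : nullSet (A ∪ B) :=
  nullSet_iff_tendsto.2 <| squeeze_zero (nuN_nonneg _) (nuN_union_le A B) <| by
    simpa using (nullSet_iff_tendsto.1 hA).add (nullSet_iff_tendsto.1 hB)

theorem nullSet_Iic (m : ℕ) : nullSet (Set.Iic m) := by
  refine nullSet_iff_tendsto.2 <| squeeze_zero (nuN_nonneg _) (fun N => ?_)
    (tendsto_const_div_atTop_nhds_zero_nat (m : ℝ))
  refine div_le_div_of_nonneg_right ?_ N.cast_nonneg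
  rw [Finset.sum_indicator_eq_sum_filter, Finset.sum_const, nsmul_one, Nat.cast_le]
  calc _ ≤ (Finset.Icc 1 m).card := Finset.card_le_card fun n => by simp; omega
    _ = m := by simp

theorem nullSet_biUnion_lt {D : ℕ → Set ℕ} (k : ℕ) (hD : ∀ j < k, nullSet (D j)) :
    nullSet (⋃ j < k, D j) := by
  induction k with
  | zero => exact (nullSet_Iic 0).mono (by simp)
  | succ k ih =>
    rw [Set.biUnion_lt_succ]
    exact (ih fun j hj => hD j (hj.trans k.lt_succ_self)).union (hD k k.lt_succ_self)

theorem tendsto_nuN_of_nullSet_symmDiff {A B : Set ℕ} {l : ℝ} (hA : Tendsto (nuN A) atTop (𝓝 l))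
    (h : nullSet (symmDiff A B)) : Tendsto (nuN B) atTop (𝓝 l) := by
  have : Tendsto (fun N => nuN A N - nuN B N) atTop (𝓝 0) :=
    squeeze_zero_norm (abs_nuN_sub_le A B) (nullSet_iff_tendsto.1 h)
  simpa using hA.sub this

theorem tendsto_nuN_iUnion {D : ℕ → Set ℕ} (hD : Pairwise (Function.onFun Disjoint D))
    {a b : ℕ → ℝ} (hb : Summable b) (ha : ∀ k, Tendsto (nuN (D k)) atTop (𝓝 (a k)))
    (hab : ∀ k N, nuN (D k) N ≤ b k) : Tendsto (nuN (⋃ k, D k)) atTop (𝓝 (∑' k, a k)) := by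
  have := tendsto_tsum_of_dominated_convergence hb ha (Eventually.of_forall fun N k => by
    rw [Real.norm_of_nonneg (nuN_nonneg _ _)]
    exact hab k N)
  simpa only [(hasSum_nuN_iUnion hD _).tsum_eq] using this

theorem summable_of_tendsto_nuN {D : ℕ → Set ℕ} (hD : Pairwise (Function.onFun Disjoint D))
    {a : ℕ → ℝ} (ha : ∀ k, Tendsto (nuN (D k)) atTop (𝓝 (a k))) : Summable a := by
  refine summable_of_sum_le (fun k => ge_of_tendsto' (ha k) (nuN_nonneg _)) (c := 1) fun s => ?_
  refine le_of_tendsto' (tendsto_finsetSum s fun k _ => ha k) fun N => ?_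
  exact (sum_le_hasSum s (fun k _ => nuN_nonneg _ _) (hasSum_nuN_iUnion hD N)).trans
    (nuN_le_one _ N)

theorem nuN_diff_Iic_eq_zero (A : Set ℕ) {m N : ℕ} (h : N ≤ m) : nuN (A \ Set.Iic m) N = 0 := by
  rw [nuN, Finset.sum_eq_zero, zero_div]
  intro n hn
  exact Set.indicator_of_notMem (fun hn' => hn'.2 ((Finset.mem_Icc.1 hn).2.trans h)) _

theorem stmt17 (A : ℕ → Set ℕ) (hF : ∀ k, memF (A k))
    (h : ∀ j k : ℕ, j ≠ k → nullSet (A j ∩ A k)) :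
    ∃ B : ℕ → Set ℕ,
      (∀ k, memF (B k)) ∧
      (∀ k, nullSet (symmDiff (A k) (B k))) ∧
      Pairwise (Function.onFun Disjoint B) ∧
      memF (⋃ k, B k) ∧ nu (⋃ k, B k) = ∑' k, nu (B k) ∧
      (∀ C : Set ℕ, (∀ k, nullSet (A k \ C)) → nullSet ((⋃ k, B k) \ C)) := by
  have hnull (k : ℕ) (m : ℕ) : nullSet (symmDiff (A k) (disjointed A k \ Set.Iic m)) := by
    refine ((nullSet_biUnion_lt k fun j hj => h j k hj.ne).union (nullSet_Iic m)).mono ?_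
    intro n hn
    simp only [disjointed_eq_inter_compl, Set.mem_symmDiff, Set.mem_sdiff, Set.mem_inter_iff,
      Set.mem_iInter, Set.mem_compl_iff, Set.mem_union, Set.mem_iUnion, exists_prop] at hn ⊢
    grind
  have hdisj : Pairwise (Function.onFun Disjoint (disjointed A)) := disjoint_disjointed A
  have hlim (k : ℕ) : Tendsto (nuN (disjointed A k)) atTop (𝓝 (nu (A k))) := by
    refine tendsto_nuN_of_nullSet_symmDiff (hF k).tendsto_nu
      (((hnull k 0).union (nullSet_Iic 0)).mono fun n hn => ?_)
    simp only [Set.mem_symmDiff, Set.mem_sdiff, Set.mem_union] at hn ⊢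
    tauto
  have hm (k : ℕ) : ∃ m, ∀ N ≥ m, nuN (disjointed A k) N ≤ nu (A k) + (1 / 2) ^ k :=
    eventually_atTop.1 <| (hlim k).eventually_le_const (lt_add_of_pos_right _ (by positivity))
  choose m hm using hm
  let B (k : ℕ) : Set ℕ := disjointed A k \ Set.Iic (m k)
  have hBdisj : Pairwise (Function.onFun Disjoint B) := fun i j hij =>
    (hdisj hij).mono Set.sdiff_subset Set.sdiff_subset
  have hBlim (k : ℕ) : Tendsto (nuN (B k)) atTop (𝓝 (nu (A k))) :=
    tendsto_nuN_of_nullSet_symmDiff (hF k).tendsto_nu (hnull k (m k))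
  have hbound (k N : ℕ) : nuN (B k) N ≤ nu (A k) + (1 / 2) ^ k := by
    rcases le_total N (m k) with hN | hN
    · rw [nuN_diff_Iic_eq_zero _ hN]
      have := ge_of_tendsto' (hBlim k) (nuN_nonneg _)
      positivity
    · exact (nuN_mono Set.sdiff_subset N).trans (hm k N hN)
  have hsum : Summable fun k => nu (A k) + (1 / 2 : ℝ) ^ k :=
    (summable_of_tendsto_nuN hBdisj hBlim).add summable_geometric_two
  have hU := tendsto_nuN_iUnion hBdisj hsum hBlim hbound
  refine ⟨B, fun k => memF_of_tendsto (hBlim k), fun k => hnull k (m k), hBdisj,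
    memF_of_tendsto hU, ?_, fun C hC => ?_⟩
  · simp only [nu_eq_of_tendsto hU, fun k => nu_eq_of_tendsto (hBlim k)]
  · have hsub (k : ℕ) : B k \ C ⊆ A k \ C :=
      Set.sdiff_subset_sdiff_left (Set.sdiff_subset.trans (disjointed_subset A k))
    rw [Set.iUnion_sdiff, nullSet_iff_tendsto, ← tsum_zero (α := ℝ) (β := ℕ)]
    exact tendsto_nuN_iUnion
      (fun i j hij => (hBdisj hij).mono Set.sdiff_subset Set.sdiff_subset) hsum
      (fun k => nullSet_iff_tendsto.1 ((hC k).mono (hsub k)))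
      fun k N => (nuN_mono Set.sdiff_subset N).trans (hbound k N)
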